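/- Assume assertion (A2) and assertion (A3) hold, and assume in addition that κ_{j+1} ⊆ L_j for all 0 ≤ j < r. Then for every 0 ≤ i < r, the splitting field L_{i+1} of F_{i+1} equals L_i(√δ_i), and it is a nontrivial quadratic extension of L_i, i.e. [L_{i+1} : L_i] = 2. -/

import Mathlib

open Matrix Polynomial

noncomputable section

abbrev Om := AlgebraicClosure ℚ

def Sgrp (ℓ i : ℕ) [Fact ℓ.Prime] : Subgroup (ZMod ℓ)ˣ :=
  MonoidHom.range (powMonoidHom (2 ^ i) : (ZMod ℓ)ˣ →* (ZMod ℓ)ˣ)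

def scalarGL (ℓ : ℕ) [Fact ℓ.Prime] : (ZMod ℓ)ˣ →* GL (Fin 2) (ZMod ℓ) :=
  Units.map (Matrix.scalar (Fin 2)).toMonoidHom

lemma scalarGL_mem_center (ℓ : ℕ) [Fact ℓ.Prime] (s : (ZMod ℓ)ˣ) :
    scalarGL ℓ s ∈ Subgroup.center (GL (Fin 2) (ZMod ℓ)) := by
  rw [Subgroup.mem_center_iff]
  intro g
  ext : 1
  simp only [Units.val_mul, scalarGL, Units.coe_map, RingHom.toMonoidHom_eq_coe,
    MonoidHom.coe_coe]
  exact (Matrix.scalar_commute ((s : ZMod ℓ)) (fun r => Commute.all _ _) g.val).symm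

def ZS (ℓ i : ℕ) [Fact ℓ.Prime] : Subgroup (GL (Fin 2) (ZMod ℓ)) :=
  (Sgrp ℓ i).map (scalarGL ℓ)

instance (ℓ i : ℕ) [Fact ℓ.Prime] : (ZS ℓ i).Normal := by
  constructor
  intro n hn g
  have hcen : n ∈ Subgroup.center (GL (Fin 2) (ZMod ℓ)) := by
    obtain ⟨s, _, rfl⟩ := hn
    exact scalarGL_mem_center ℓ s
  have h := (Subgroup.mem_center_iff.mp hcen) g
  have : g * n * g⁻¹ = n := by rw [h, mul_assoc, mul_inv_cancel, mul_one]
  rwa [this]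

lemma Sgrp_le_zero (ℓ i : ℕ) [Fact ℓ.Prime] : Sgrp ℓ i ≤ Sgrp ℓ 0 := by
  intro u _
  exact ⟨u, by simp [powMonoidHom]⟩

lemma Sgrp_succ_le (ℓ i : ℕ) [Fact ℓ.Prime] : Sgrp ℓ (i + 1) ≤ Sgrp ℓ i := by
  rintro u ⟨y, rfl⟩
  exact ⟨y ^ 2, by simp only [powMonoidHom_apply]; rw [← pow_mul, ← pow_succ']⟩

def projQ (ℓ i : ℕ) [Fact ℓ.Prime] :
    (GL (Fin 2) (ZMod ℓ) ⧸ ZS ℓ i) →* (GL (Fin 2) (ZMod ℓ) ⧸ ZS ℓ 0) :=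
  QuotientGroup.map _ _ (MonoidHom.id _)
    (fun _ h => Subgroup.map_mono (Sgrp_le_zero ℓ i) h)

def Vset (ℓ : ℕ) : Type := {v : Fin 2 → ZMod ℓ // v ≠ 0}

def vSetoid (ℓ i : ℕ) [Fact ℓ.Prime] : Setoid (Vset ℓ) :=
  ⟨fun v w => ∃ s ∈ Sgrp ℓ i, (s : ZMod ℓ) • v.1 = w.1, by
    constructor
    · exact fun v => ⟨1, one_mem _, by rw [Units.val_one, one_smul]⟩
    · rintro v w ⟨s, hs, hsv⟩
      exact ⟨s⁻¹, inv_mem hs, by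
        rw [← hsv, smul_smul, ← Units.val_mul, inv_mul_cancel, Units.val_one, one_smul]⟩
    · rintro u v w ⟨s, hs, hsu⟩ ⟨t, ht, htv⟩
      exact ⟨t * s, mul_mem ht hs, by rw [← htv, ← hsu, smul_smul, Units.val_mul]⟩⟩

def Vq (ℓ i : ℕ) [Fact ℓ.Prime] : Type := Quotient (vSetoid ℓ i)

def VqProj (ℓ i : ℕ) [Fact ℓ.Prime] : Vq ℓ (i + 1) → Vq ℓ i :=
  Quotient.lift (fun v => (Quotient.mk (vSetoid ℓ i) v : Vq ℓ i))
    (fun v w h => Quotient.sound (by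
      obtain ⟨s, hs, hsv⟩ := h
      exact ⟨s, Sgrp_succ_le ℓ i hs, hsv⟩))

/-- The action of `GL₂(F_ℓ)` on `V = F_ℓ² ∖ {0}`. -/
def glAct (ℓ : ℕ) [Fact ℓ.Prime] (A : GL (Fin 2) (ZMod ℓ)) (v : Vset ℓ) : Vset ℓ :=
  ⟨(A : Matrix (Fin 2) (Fin 2) (ZMod ℓ)).mulVec v.1, by
    intro h0
    apply v.2
    have := congrArg ((A⁻¹ : GL (Fin 2) (ZMod ℓ)) : Matrix (Fin 2) (Fin 2) (ZMod ℓ)).mulVec h0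
    rwa [Matrix.mulVec_mulVec, ← Units.val_mul, inv_mul_cancel, Units.val_one,
      Matrix.one_mulVec, Matrix.mulVec_zero] at this⟩

/-- The induced action of `GL₂(F_ℓ)/S_i` on `V_i = V/S_i`. -/
def qAct (ℓ i : ℕ) [Fact ℓ.Prime] (g : GL (Fin 2) (ZMod ℓ) ⧸ ZS ℓ i) (x : Vq ℓ i) :
    Vq ℓ i :=
  Quotient.liftOn' g
    (fun A => Quotient.lift
      (fun v => (Quotient.mk (vSetoid ℓ i) (glAct ℓ A v) : Vq ℓ i))
      (fun v w h => Quotient.sound (by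
        obtain ⟨s, hs, hsv⟩ := h
        exact ⟨s, hs, by
          show (s : ZMod ℓ) • ((A : Matrix (Fin 2) (Fin 2) (ZMod ℓ)).mulVec v.1) = _
          rw [← Matrix.mulVec_smul, hsv]; rfl⟩)) x)
    (fun A B hAB => by
      induction x using Quotient.inductionOn with
      | h v => exact Quotient.sound (by
          rw [QuotientGroup.leftRel_apply] at hAB
          obtain ⟨s, hs, hmul⟩ := hAB
          refine ⟨s, hs, ?_⟩
          have hB : B = A * scalarGL ℓ s := by rw [hmul, mul_inv_cancel_left]
          show (s : ZMod ℓ) • ((A : Matrix (Fin 2) (Fin 2) (ZMod ℓ)).mulVec v.1) =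
            ((B : Matrix (Fin 2) (Fin 2) (ZMod ℓ)).mulVec v.1)
          have h1 : ((scalarGL ℓ s : GL (Fin 2) (ZMod ℓ)) :
              Matrix (Fin 2) (Fin 2) (ZMod ℓ)) =
              (s : ZMod ℓ) • (1 : Matrix (Fin 2) (Fin 2) (ZMod ℓ)) := by
            simp [scalarGL, Matrix.scalar, Matrix.smul_one_eq_diagonal]
          rw [hB, Units.val_mul, h1, Matrix.mul_smul, mul_one,
            Matrix.smul_mulVec]))

/-- The diagonal matrix `diag(1, -1)` as an element of `GL₂(R)`. -/
def diagOneNegOne (R : Type*) [CommRing R] : GL (Fin 2) R :=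
  ⟨Matrix.diagonal ![1, -1], Matrix.diagonal ![1, -1],
    by
      rw [Matrix.diagonal_mul_diagonal]
      convert Matrix.diagonal_one using 2
      funext i
      fin_cases i <;> simp,
    by
      rw [Matrix.diagonal_mul_diagonal]
      convert Matrix.diagonal_one using 2
      funext i
      fin_cases i <;> simp⟩

end

section

open NumberField

theorem Polynomial.Splits.of_map_ringOfIntegers {L : Type*} [Field L] [NumberField L] {g : ℤ[X]}
    (hg : g.Monic) (hs : (g.map (Int.castRingHom L)).Splits) :
    (g.map (Int.castRingHom (𝓞 L))).Splits := by
  have hcomp : (algebraMap (𝓞 L) L).comp (Int.castRingHom (𝓞 L)) = Int.castRingHom L :=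
    RingHom.ext_int _ _
  have hm := hg.map (Int.castRingHom L)
  have hint : ∀ x ∈ (g.map (Int.castRingHom L)).roots, IsIntegral ℤ x := by
    intro x hx
    refine ⟨g, hg, ?_⟩
    have := (mem_roots'.mp hx).2
    rwa [IsRoot, eval_map] at this
  have key : ∃ s : Multiset (𝓞 L),
      s.map (algebraMap (𝓞 L) L) = (g.map (Int.castRingHom L)).roots := by
    have : CanLift L (𝓞 L) (algebraMap (𝓞 L) L) (IsIntegral ℤ) := ⟨fun x hx => ⟨⟨x, hx⟩, rfl⟩⟩
    exact CanLift.prf _ hint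
  obtain ⟨s, hs'⟩ := key
  have : g.map (Int.castRingHom (𝓞 L)) = (s.map fun x => X - C x).prod := by
    apply Polynomial.map_injective _ (RingOfIntegers.coe_injective (K := L))
    rw [Polynomial.map_map, hcomp, hs.eq_prod_roots_of_monic hm, ← hs', Polynomial.map_multiset_prod,
      Multiset.map_map, Multiset.map_map]
    simp
  rw [this]
  refine Splits.multisetProd fun f hf => ?_
  obtain ⟨x, -, rfl⟩ := Multiset.mem_map.mp hf
  exact Splits.X_sub_C x

/-- Reduction along `φ` is injective on the roots of `f` when `f.map φ` is squarefree. -/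
theorem Polynomial.eq_of_squarefree_map {R S : Type*} [CommRing R] [IsDomain R] [Field S]
    (φ : R →+* S) {f : R[X]} (hf : Squarefree (f.map φ)) {x y : R} (hx : f.IsRoot x)
    (hy : f.IsRoot y) (hxy : φ x = φ y) : x = y := by
  by_contra hne
  obtain ⟨q, rfl⟩ := dvd_iff_isRoot.mpr hx
  have hq : q.IsRoot y := by
    have := hy
    rw [IsRoot, eval_mul, eval_sub, eval_X, eval_C, mul_eq_zero, sub_eq_zero] at this
    exact this.resolve_left fun h => hne h.symm
  obtain ⟨q, rfl⟩ := dvd_iff_isRoot.mpr hq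
  have := hf (X - C (φ x)) ⟨q.map φ, by
    simp only [Polynomial.map_mul, Polynomial.map_sub, map_X, map_C, ← hxy]; ring⟩
  exact not_isUnit_X_sub_C _ this

/-- If `f` is squarefree and split modulo a prime `v`, and its roots generate a Galois number field
`L` over which `g` splits, then `g` splits modulo `v`: a Frobenius at a prime of `L` above `v` fixes
every root of `f`, hence is trivial. -/
theorem Polynomial.splits_map_zmod_of_splits {L : Type*} [Field L] [NumberField L] [IsGalois ℚ L]
    {f g : ℤ[X]} (hf : f.Monic) (hg : g.Monic)
    (hgen : ∀ σ : Gal(L/ℚ), (∀ x : L, aeval x f = 0 → σ x = x) → σ = 1)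
    (hgs : (g.map (Int.castRingHom L)).Splits) (v : ℕ) [Fact v.Prime]
    (hsq : Squarefree (f.map (Int.castRingHom (ZMod v))))
    (hfs : (f.map (Int.castRingHom (ZMod v))).Splits) :
    (g.map (Int.castRingHom (ZMod v))).Splits := by
  have hv : v.Prime := Fact.out
  have hvmax : (Ideal.span {(v : ℤ)}).IsMaximal :=
    PrincipalIdealRing.isMaximal_of_irreducible (Nat.prime_iff_prime_int.mp hv).irreducible
  obtain ⟨P, hP, hPv⟩ :=
    Ideal.exists_maximal_ideal_liesOver_of_isIntegral (S := 𝓞 L) (Ideal.span {(v : ℤ)})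
  have hunder : P.under ℤ = Ideal.span {(v : ℤ)} := hPv.over.symm
  let _ : Field (𝓞 L ⧸ P) := Ideal.Quotient.field P
  have hcard : Nat.card (ℤ ⧸ P.under ℤ) = v := by
    rw [hunder, Nat.card_congr (Int.quotientSpanNatEquivZMod v).toEquiv, Nat.card_zmod]
  have hv0 : (v : 𝓞 L ⧸ P) = 0 := by
    have : (v : ℤ) ∈ P.under ℤ := hunder ▸ Ideal.mem_span_singleton_self _
    have := Ideal.mem_comap.mp this
    rw [← Ideal.Quotient.eq_zero_iff_mem] at this
    simpa using this
  have : CharP (𝓞 L ⧸ P) v := (CharP.charP_iff_prime_eq_zero hv).mpr hv0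
  have hPbot : P ≠ ⊥ := by
    rintro rfl
    have : (v : 𝓞 L) = 0 := by
      have h := hv0
      rw [← map_natCast (Ideal.Quotient.mk (⊥ : Ideal (𝓞 L))), Ideal.Quotient.eq_zero_iff_mem] at h
      simpa using h
    exact hv.ne_zero (by exact_mod_cast this)
  have : Finite (𝓞 L ⧸ P) := Ideal.finiteQuotientOfFreeOfNeBot P hPbot
  let c := ZMod.castHom (dvd_refl v) (𝓞 L ⧸ P)
  have hc : c.comp (Int.castRingHom (ZMod v)) = (Ideal.Quotient.mk P).comp (Int.castRingHom (𝓞 L)) :=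
    RingHom.ext_int _ _
  have hsq' : Squarefree ((f.map (Int.castRingHom (𝓞 L))).map (Ideal.Quotient.mk P)) := by
    rw [Polynomial.map_map, ← hc, ← Polynomial.map_map]
    exact ((PerfectField.separable_iff_squarefree.mpr hsq).map).squarefree
  obtain ⟨σ, hσ⟩ := IsArithFrobAt.exists_of_isInvariant ℤ (Gal(L/ℚ)) P
  have hfrob : ∀ x : 𝓞 L, Ideal.Quotient.mk P (σ • x) = (Ideal.Quotient.mk P x) ^ v := by
    intro x
    have := hσ.mk_apply x
    rwa [hcard] at this
  have hpow : ∀ a : ZMod v, c a ^ v = c a := fun a => by rw [← map_pow, ZMod.pow_card]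
  have hone : σ = 1 := by
    refine hgen σ fun x hx => ?_
    have hxi : IsIntegral ℤ x := ⟨f, hf, hx⟩
    let y : 𝓞 L := ⟨x, hxi⟩
    have hroot : ∀ w : 𝓞 L, aeval (w : L) f = 0 → (f.map (Int.castRingHom (𝓞 L))).IsRoot w := by
      intro w hw
      apply RingOfIntegers.coe_injective
      rw [map_zero, ← hw, eval_map, hom_eval₂, aeval_def]
      congr 1
    have h1 := hroot y hx
    have h2 : (f.map (Int.castRingHom (𝓞 L))).IsRoot (σ • y) := by
      apply hroot
      have : ((σ • y : 𝓞 L) : L) = σ x := rfl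
      rw [this]
      have h3 := congrArg (σ.toAlgHom.restrictScalars ℤ) hx
      rw [← Polynomial.aeval_algHom_apply, map_zero] at h3
      exact h3
    have h3 : (Ideal.Quotient.mk P y) ∈ c.range := by
      refine hfs.mem_range_of_isRoot (i := c) (hf.map _).ne_zero ?_
      rw [Polynomial.map_map, hc, ← Polynomial.map_map]
      exact h1.map
    obtain ⟨a, ha⟩ := h3
    have h4 := eq_of_squarefree_map (Ideal.Quotient.mk P) hsq' h2 h1 (by
      rw [hfrob, ← ha, hpow])
    exact congrArg (algebraMap (𝓞 L) L) h4
  subst hone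
  refine Splits.of_splits_map c ?_ ?_
  · rw [Polynomial.map_map, hc, ← Polynomial.map_map]
    exact (Splits.of_map_ringOfIntegers hg hgs).map _
  · intro a _
    obtain ⟨a, rfl⟩ := Ideal.Quotient.mk_surjective a
    have := hfrob a
    rw [one_smul] at this
    refine Splits.mem_range_of_isRoot (f := X ^ v - X) ?_
      (FiniteField.X_pow_card_sub_X_ne_zero _ hv.one_lt) (by simp [← this])
    simpa using Polynomial.splits_X_pow_nat_card_sub_X (K := ZMod v)

theorem IntermediateField.exists_add_mul_of_mem_sup_adjoin {F E : Type*} [Field F] [Field E]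
    [Algebra F E] (S : IntermediateField F E) {γ : E} (hγ : γ ^ 2 ∈ S) {x : E}
    (hx : x ∈ S ⊔ adjoin F {γ}) : ∃ a ∈ S, ∃ b ∈ S, x = a + b * γ := by
  rw [← restrictScalars_adjoin_eq_sup, mem_restrictScalars] at hx
  have halg : IsAlgebraic S γ := ⟨X ^ 2 - C ⟨_, hγ⟩, (monic_X_pow_sub_C _ two_ne_zero).ne_zero,
    by simp⟩
  rw [← mem_toSubalgebra, adjoin_simple_toSubalgebra_of_isAlgebraic halg] at hx
  induction hx using Algebra.adjoin_induction with
  | mem x hx => exact ⟨0, S.zero_mem, 1, S.one_mem, by simpa using hx⟩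
  | algebraMap s => exact ⟨s, s.2, 0, S.zero_mem, by simp⟩
  | add x y _ _ hx hy =>
    obtain ⟨a, ha, b, hb, rfl⟩ := hx
    obtain ⟨a', ha', b', hb', rfl⟩ := hy
    exact ⟨_, add_mem ha ha', _, add_mem hb hb', by ring⟩
  | mul x y _ _ hx hy =>
    obtain ⟨a, ha, b, hb, rfl⟩ := hx
    obtain ⟨a', ha', b', hb', rfl⟩ := hy
    exact ⟨a * a' + b * b' * γ ^ 2, add_mem (mul_mem ha ha') (mul_mem (mul_mem hb hb') hγ),
      a * b' + b * a', add_mem (mul_mem ha hb') (mul_mem hb ha'), by ring⟩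

theorem IntermediateField.finrank_extendScalars_eq_two {F E : Type*} [Field F] [Field E]
    [Algebra F E] {S T : IntermediateField F E} (h : S ≤ T) {γ : E} (hγ : γ ^ 2 ∈ S)
    (hT : T = S ⊔ adjoin F {γ}) (hne : T ≠ S) :
    Module.finrank S (extendScalars h) = 2 := by
  have hnot : γ ∉ S := fun hmem =>
    hne (by rw [hT, sup_eq_left, adjoin_simple_le_iff]; exact hmem)
  have hext : extendScalars h = adjoin S {γ} := by
    apply restrictScalars_injective F
    rw [restrictScalars_adjoin_eq_sup, extendScalars_restrictScalars, hT]
  have hroot : aeval γ (X ^ 2 - C (⟨_, hγ⟩ : S)) = 0 := by simp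
  have hmon : (X ^ 2 - C (⟨_, hγ⟩ : S)).Monic := monic_X_pow_sub_C _ two_ne_zero
  have hint : IsIntegral S γ := ⟨_, hmon, hroot⟩
  rw [hext, adjoin.finrank hint]
  apply le_antisymm
  · have := natDegree_le_of_dvd (minpoly.dvd S γ hroot) hmon.ne_zero
    rwa [natDegree_X_pow_sub_C] at this
  · rw [minpoly.two_le_natDegree_iff hint]
    rintro ⟨y, rfl⟩
    exact hnot y.2

theorem IntermediateField.normal_of_le_adjoin_rootsOfUnity {F E : Type*} [Field F] [Field E]
    [Algebra F E] [IsAlgClosed E] {n : ℕ} [NeZero (n : E)] {k : IntermediateField F E}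
    (hk : k ≤ adjoin F {x : E | x ^ n = 1}) : Normal F k := by
  have hn : n ≠ 0 := fun h => NeZero.ne (n : E) (by simp [h])
  have hset : {x : E | x ^ n = 1} = {b : E | ∃ m ∈ ({n} : Set ℕ), m ≠ 0 ∧ b ^ m = 1} := by
    ext; simp [hn]
  have hcyc : IsCyclotomicExtension {n} F (adjoin F {x : E | x ^ n = 1}) := by
    rw [hset]
    refine isCyclotomicExtension_adjoin_of_exists_isPrimitiveRoot {n} F E ?_
    rintro m rfl -
    exact HasEnoughRootsOfUnity.exists_primitiveRoot E m
  have := IsCyclotomicExtension.isAbelianGalois {n} F (adjoin F {x : E | x ^ n = 1})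
  let _ := (inclusion hk).toAlgebra
  have : IsScalarTower F k (adjoin F {x : E | x ^ n = 1}) := .of_algebraMap_eq fun _ => rfl
  have := IsAbelianGalois.tower_bot F k (adjoin F {x : E | x ^ n = 1})
  infer_instance

/-- If `k` is normal over `F`, not contained in `F(γ²)`, and embeds in `F[x]/(R(x²))`, where `R` is
the minimal polynomial of `γ²`, then `γ` lies in the compositum of `F(γ²)` and `k`. -/
theorem IntermediateField.mem_sup_of_not_le_of_algHom {F E : Type*} [Field F] [Field E]
    [Algebra F E] {k : IntermediateField F E} [Normal F k] {β γ : E} (hγ : γ ^ 2 = β)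
    (hk : ¬ k ≤ adjoin F {β})
    (f : k →ₐ[F] (F[X] ⧸ Ideal.span {(minpoly F β).comp (X ^ 2 : F[X])})) :
    γ ∈ adjoin F {β} ⊔ k := by
  have hroot : aeval γ ((minpoly F β).comp (X ^ 2 : F[X])) = 0 := by
    rw [aeval_comp, map_pow, aeval_X, hγ, minpoly.aeval]
  let e : (F[X] ⧸ Ideal.span {(minpoly F β).comp (X ^ 2 : F[X])}) →ₐ[F] E :=
    Ideal.Quotient.liftₐ _ (aeval γ) (fun p hp => by
      obtain ⟨q, rfl⟩ := Ideal.mem_span_singleton.mp hp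
      rw [map_mul, hroot, zero_mul])
  have hle : k ≤ adjoin F {γ} := by
    rw [← AlgHom.fieldRange_of_normal (e.comp f)]
    rintro _ ⟨y, rfl⟩
    obtain ⟨p, hp⟩ := Ideal.Quotient.mk_surjective (f y)
    change e (f y) ∈ _
    rw [← hp]
    change aeval γ p ∈ _
    exact algebra_adjoin_le_adjoin F _ (aeval_mem_adjoin_singleton F γ)
  obtain ⟨x, hxk, hx⟩ := SetLike.not_le_iff_exists.mp hk
  obtain ⟨a, ha, b, hb, hab⟩ := exists_add_mul_of_mem_sup_adjoin (adjoin F {β})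
    (γ := γ) (hγ ▸ mem_adjoin_simple_self F _) (le_sup_right (a := adjoin F {β}) (hle hxk))
  have hb0 : b ≠ 0 := by
    rintro rfl
    rw [zero_mul, add_zero] at hab
    exact hx (hab ▸ ha)
  have : γ = (x - a) / b := by
    rw [hab]; field_simp; ring
  rw [this]
  have hl : adjoin F {β} ≤ adjoin F {β} ⊔ k := le_sup_left
  have hr : k ≤ adjoin F {β} ⊔ k := le_sup_right
  exact div_mem (sub_mem (hr hxk) (hl ha)) (hl hb)

theorem Polynomial.Splits.exists_fin_prod {R : Type*} [CommRing R] [IsDomain R] {f : R[X]}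
    (hf : f.Splits) (hm : f.Monic) {n : ℕ} (hn : f.natDegree = n) :
    ∃ g : Fin n → R, f = ∏ i, (X - C (g i)) := by
  have hlen : f.roots.toList.length = n := by
    rw [Multiset.length_toList, ← hn, hf.natDegree_eq_card_roots]
  subst hlen
  refine ⟨f.roots.toList.get, ?_⟩
  conv_lhs => rw [hf.eq_prod_roots_of_monic hm, ← f.roots.coe_toList]
  rw [Multiset.map_coe, Multiset.prod_coe, ← List.prod_ofFn]
  congr 1
  conv_lhs => rw [← List.ofFn_get f.roots.toList, List.map_ofFn]
  rfl

theorem Polynomial.Monic.exists_algEquiv_of_mem_rootSet {E : Type*} [Field E] [Algebra ℚ E]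
    [Normal ℚ E] {f : ℤ[X]} (hf : f.Monic) (hirr : Irreducible f) {x y : E}
    (hx : x ∈ f.rootSet E) (hy : y ∈ f.rootSet E) : ∃ σ : E ≃ₐ[ℚ] E, σ x = y := by
  have hirr' : Irreducible (f.map (algebraMap ℤ ℚ)) :=
    hf.irreducible_iff_irreducible_map_fraction_map.mp hirr
  have hmin : ∀ w ∈ f.rootSet E, minpoly ℚ w = f.map (algebraMap ℤ ℚ) := fun w hw =>
    (minpoly.eq_of_irreducible_of_monic hirr'
      (by rw [aeval_map_algebraMap]; exact (mem_rootSet'.mp hw).2) (hf.map _)).symm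
  refine minpoly.exists_algEquiv_of_root (Algebra.IsAlgebraic.isAlgebraic y) ?_
  rw [hmin y hy, ← hmin x hx, minpoly.aeval]

theorem Polynomial.algEquiv_mem_rootSet {E : Type*} [Field E] [Algebra ℚ E]
    (f : ℤ[X]) (σ : E ≃ₐ[ℚ] E) {x : E} (hx : x ∈ f.rootSet E) : σ x ∈ f.rootSet E := by
  rw [mem_rootSet'] at hx ⊢
  refine ⟨hx.1, ?_⟩
  rw [← map_zero σ, ← hx.2]
  exact Polynomial.aeval_algHom_apply (σ.toAlgHom.restrictScalars ℤ) x f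

theorem Polynomial.isSplittingField_adjoin_rootSet_int {F E : Type*} [Field F] [Field E]
    [Algebra F E] [IsAlgClosed E] (f : ℤ[X]) :
    IsSplittingField F (IntermediateField.adjoin F (f.rootSet E)) (f.map (algebraMap ℤ F)) := by
  have : f.rootSet E = (f.map (algebraMap ℤ F)).rootSet E := by
    rw [rootSet, rootSet, aroots_map]
  rw [this]
  exact IntermediateField.adjoin_rootSet_isSplittingField (IsAlgClosed.splits _)

theorem Polynomial.normal_adjoin_rootSet_int {F E : Type*} [Field F] [Field E]
    [Algebra F E] [IsAlgClosed E] (f : ℤ[X]) :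
    Normal F (IntermediateField.adjoin F (f.rootSet E)) :=
  have := f.isSplittingField_adjoin_rootSet_int (F := F) (E := E)
  Normal.of_isSplittingField (f.map (algebraMap ℤ F))

theorem Polynomial.finiteDimensional_adjoin_rootSet_int {F E : Type*} [Field F] [Field E]
    [Algebra F E] [IsAlgClosed E] (f : ℤ[X]) :
    FiniteDimensional F (IntermediateField.adjoin F (f.rootSet E)) :=
  have := f.isSplittingField_adjoin_rootSet_int (F := F) (E := E)
  IsSplittingField.finiteDimensional _ (f.map (algebraMap ℤ F))

theorem Polynomial.splits_map_zmod_of_rootSet_subset {E : Type*} [Field E] [Algebra ℚ E]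
    [IsAlgClosed E] {f g : ℤ[X]} (hf : f.Monic) (hg : g.Monic)
    (hfg : g.rootSet E ⊆ IntermediateField.adjoin ℚ (f.rootSet E)) (v : ℕ) [Fact v.Prime]
    (hsq : Squarefree (f.map (Int.castRingHom (ZMod v))))
    (hfs : (f.map (Int.castRingHom (ZMod v))).Splits) :
    (g.map (Int.castRingHom (ZMod v))).Splits := by
  have h1 := f.normal_adjoin_rootSet_int (F := ℚ) (E := E)
  have h2 := f.finiteDimensional_adjoin_rootSet_int (F := ℚ) (E := E)
  set L := IntermediateField.adjoin ℚ (f.rootSet E)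
  have : CharZero E := algebraRat.charZero E
  have : CharZero L := algebraRat.charZero L
  have halg : (DivisionRing.toRatAlgebra : Algebra ℚ L) = L.algebra' := Subsingleton.elim _ _
  have : NumberField L := { to_finiteDimensional := by rw [halg]; exact h2 }
  have : IsGalois ℚ L := { to_normal := by rw [halg]; exact h1 }
  refine splits_map_zmod_of_splits (L := L) hf hg ?_ ?_ v hsq hfs
  · intro σ hσ
    ext ⟨x, hx⟩
    congr 1
    change σ ⟨x, hx⟩ = ⟨x, hx⟩
    induction hx using IntermediateField.adjoin_induction with
    | mem x hx =>
      refine hσ _ (Subtype.coe_injective ?_)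
      exact (aeval_algHom_apply (algebraMap L E).toIntAlgHom _ f).symm.trans (mem_rootSet'.mp hx).2
    | algebraMap x =>
      have : (⟨algebraMap ℚ E x, L.algebraMap_mem x⟩ : L) = (x : L) :=
        eq_ratCast (L.algebra'.algebraMap) x
      rw [this, map_ratCast]
    | add x y hx hy h h' => exact (map_add σ ⟨x, hx⟩ ⟨y, hy⟩).trans (congrArg₂ (· + ·) h h')
    | inv x hx h => exact (map_inv₀ σ ⟨x, hx⟩).trans (congrArg Inv.inv h)
    | mul x y hx hy h h' => exact (map_mul σ ⟨x, hx⟩ ⟨y, hy⟩).trans (congrArg₂ (· * ·) h h')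
  · refine Splits.of_splits_map (algebraMap L E) (IsAlgClosed.splits _) fun a ha => ?_
    rw [Polynomial.map_map] at ha
    refine ⟨⟨a, hfg ?_⟩, rfl⟩
    rw [mem_rootSet']
    have hint : (algebraMap L E).comp (Int.castRingHom L) = algebraMap ℤ E := RingHom.ext_int _ _
    rw [hint, mem_roots'] at ha
    exact ⟨ha.1, by rw [aeval_def, ← eval_map]; exact ha.2⟩

end

open IntermediateField in
/-- Lemma `lem_Lquad` of the paper. Assuming (A2), (A3), and that
`κ_{j+1} ⊆ L_j` for all `0 ≤ j < r`, for every `0 ≤ i < r` the splitting field `L_{i+1}`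
of `F_{i+1}` equals `L_i(√δ_i)`, and it is a nontrivial quadratic extension of `L_i`,
i.e. `[L_{i+1} : L_i] = 2`. -/
theorem splitting_fields_tower_quadratic
    (ℓ r m : ℕ) [Fact ℓ.Prime] (hℓ5 : 5 ≤ ℓ) (hm : Odd m) (hrm : ℓ - 1 = 2 ^ r * m)
    (F : ℕ → Polynomial ℤ)
    (hFmonic : ∀ i ≤ r, (F i).Monic)
    (hFirr : ∀ i ≤ r, Irreducible (F i))
    (hFdeg : ∀ i ≤ r, (F i).natDegree = 2 ^ i * (ℓ + 1))
    (z : ℕ → Om) (hz : ∀ i ≤ r, z i ∈ (F i).rootSet Om)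
    (K : ℕ → IntermediateField ℚ Om) (hK : ∀ i ≤ r, K i = ℚ⟮z i⟯)
    (L : ℕ → IntermediateField ℚ Om)
    (hL : ∀ i ≤ r, L i = IntermediateField.adjoin ℚ ((F i).rootSet Om))
    (hZL : ∀ i ≤ r, ∀ x ∈ (F i).rootSet Om, x ∈ L i)
    (hLmono : ∀ i < r, L i ≤ L (i + 1))
    (hL0le : ∀ i ≤ r, L 0 ≤ L i)
    (κ : ℕ → IntermediateField ℚ Om)
    (hκ0 : κ 0 = ⊥)
    (hκmono : ∀ i < r, κ i < κ (i + 1))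
    (hκcyclo : ∀ i ≤ r, κ i ≤ IntermediateField.adjoin ℚ {x : Om | x ^ ℓ = 1})
    (hκdeg : ∀ i ≤ r, Module.finrank ℚ ↥(κ i) = 2 ^ i)
    (θ : ∀ i, i ≤ r → (↥((F i).rootSet Om) ≃ Vq ℓ i))
    (hθcompat : ∀ i (hir : i < r), ∀ y : ↥((F i).rootSet Om),
      (y : Om) = ∑ᶠ (x : ↥((F (i + 1)).rootSet Om))
        (_ : VqProj ℓ i (θ (i + 1) hir x) = θ i (le_of_lt hir) y), (x : Om))
    (δ : ℕ → Om) (sqrtδ : ℕ → Om)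
    (hδprim : ∀ i < r, ℚ⟮δ i⟯ = K i)
    (hδint : ∀ i < r, IsIntegral ℤ (δ i))
    (hsqrtδ : ∀ i < r, sqrtδ i ^ 2 = δ i)
    (hKsucc : ∀ i < r, K (i + 1) = K i ⊔ ℚ⟮sqrtδ i⟯)
    (φ₀ : (↥(L 0) ≃ₐ[ℚ] ↥(L 0)) ≃* (GL (Fin 2) (ZMod ℓ) ⧸ ZS ℓ 0))
    (hφ₀equiv : ∀ σ : ↥(L 0) ≃ₐ[ℚ] ↥(L 0), ∀ x y : ↥((F 0).rootSet Om),
      σ ⟨(x : Om), hZL 0 (Nat.zero_le r) (x : Om) x.2⟩ =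
        ⟨(y : Om), hZL 0 (Nat.zero_le r) (y : Om) y.2⟩ →
      θ 0 (Nat.zero_le r) y = qAct ℓ 0 (φ₀ σ) (θ 0 (Nat.zero_le r) x))
    (hφ₀conj : ∃ (ι : ↥(L 0) →+* ℂ) (σ : ↥(L 0) ≃ₐ[ℚ] ↥(L 0)),
      (∀ t : ↥(L 0), ι (σ t) = starRingEnd ℂ (ι t)) ∧
      φ₀ σ = QuotientGroup.mk (diagOneNegOne (ZMod ℓ)))
    -- assertion (A2)
    (hA2 : ∀ i < r, ∀ α α' : Om, α ∈ (minpoly ℚ (δ i)).rootSet Om →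
      α' ∈ (minpoly ℚ (δ i)).rootSet Om → α ≠ α' →
      ∃ j ≤ i, ¬ (κ (j + 1) ≤ ℚ⟮α' / α⟯) ∧
        Nonempty (↥(κ (j + 1)) →ₐ[ℚ]
          (Polynomial ℚ ⧸ Ideal.span
            {(minpoly ℚ (α' / α)).comp (Polynomial.X ^ 2 : Polynomial ℚ)})))
    -- assertion (A3)
    (hA3 : ∀ i < r, ∃ v : ℕ, v.Prime ∧
      Squarefree ((F i).map (Int.castRingHom (ZMod v))) ∧
      (∃ g : Fin ((F i).natDegree) → ZMod v,
        (F i).map (Int.castRingHom (ZMod v)) =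
          ∏ k : Fin ((F i).natDegree), (Polynomial.X - Polynomial.C (g k))) ∧
      ¬ (∃ g : Fin ((F (i + 1)).natDegree) → ZMod v,
        (F (i + 1)).map (Int.castRingHom (ZMod v)) =
          ∏ k : Fin ((F (i + 1)).natDegree), (Polynomial.X - Polynomial.C (g k))))
    -- the assumption `κ_{j+1} ⊆ L_j` for all `0 ≤ j < r`
    (hκL : ∀ j < r, κ (j + 1) ≤ L j) :
    ∀ i (hir : i < r),
      L (i + 1) = L i ⊔ ℚ⟮sqrtδ i⟯ ∧
      Module.finrank ↥(L i) ↥(IntermediateField.extendScalars (hLmono i hir)) = 2 := by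
  intro i hir
  have hir' : i + 1 ≤ r := hir
  have hLchain : ∀ j ≤ i, L j ≤ L i := by
    intro j hj
    induction i, hj using Nat.le_induction with
    | base => exact le_rfl
    | succ n hn ih => exact (ih (by lia) (by lia)).trans (hLmono n (by lia))
  have hKL : ∀ j ≤ r, K j ≤ L j := fun j hj => by
    rw [hK j hj, adjoin_simple_le_iff]
    exact hZL j hj _ (hz j hj)
  have hmapKL : ∀ σ : Om ≃ₐ[ℚ] Om, ∀ x ∈ K i, σ x ∈ L i := by
    have hle : ∀ σ : Om ≃ₐ[ℚ] Om, K i ≤ (L i).comap σ.toAlgHom := fun σ => by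
      rw [hK i hir.le, adjoin_simple_le_iff]
      exact hZL i hir.le _ ((F i).algEquiv_mem_rootSet σ (hz i hir.le))
    exact fun σ x hx => hle σ hx
  have hδK : δ i ∈ K i := hδprim i hir ▸ mem_adjoin_simple_self ℚ (δ i)
  have halg : Algebra.IsAlgebraic ℚ Om := by
    rw [Subsingleton.elim (DivisionRing.toRatAlgebra : Algebra ℚ Om) (AlgebraicClosure.instAlgebra ℚ)]
    infer_instance
  have : IsAlgClosure ℚ Om := ⟨inferInstance, halg⟩
  have : Normal ℚ Om := IsAlgClosure.normal ℚ Om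
  have hκnormal : ∀ j ≤ r, @Normal ℚ (κ j) _ _ (κ j).algebra' := fun j hj =>
    have : NeZero (ℓ : Om) := ⟨Nat.cast_ne_zero.mpr (Fact.out : ℓ.Prime).ne_zero⟩
    normal_of_le_adjoin_rootsOfUnity (hκcyclo j hj)
  have hsub : L i ≤ L i ⊔ ℚ⟮sqrtδ i⟯ := le_sup_left
  have hgen : sqrtδ i ∈ L i ⊔ ℚ⟮sqrtδ i⟯ :=
    (le_sup_right : ℚ⟮sqrtδ i⟯ ≤ _) (mem_adjoin_simple_self ℚ _)
  have hσsqrt : ∀ σ : Om ≃ₐ[ℚ] Om, σ (sqrtδ i) ∈ L i ⊔ ℚ⟮sqrtδ i⟯ := by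
    intro σ
    have hσsq : σ (sqrtδ i) ^ 2 = σ (δ i) := by rw [← map_pow, hsqrtδ i hir]
    by_cases hσδ : δ i = σ (δ i)
    · rw [← hσδ, ← hsqrtδ i hir, sq_eq_sq_iff_eq_or_eq_neg] at hσsq
      rcases hσsq with h | h <;> rw [h]
      · exact hgen
      · exact neg_mem hgen
    have hδ0 : δ i ≠ 0 := fun h => hσδ (by rw [h, map_zero])
    have hs0 : sqrtδ i ≠ 0 := fun h => hδ0 (by rw [← hsqrtδ i hir, h]; ring)
    have hint : IsIntegral ℚ (δ i) := Algebra.IsIntegral.isIntegral _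
    obtain ⟨j, hji, hnot, ⟨e⟩⟩ := hA2 i hir (δ i) (σ (δ i))
      (by rw [mem_rootSet]; exact ⟨minpoly.ne_zero hint, minpoly.aeval _ _⟩)
      (by
        rw [mem_rootSet]
        refine ⟨minpoly.ne_zero hint, ?_⟩
        rw [← minpoly.algEquiv_eq σ (δ i)]
        exact minpoly.aeval _ _) hσδ
    have := hκnormal (j + 1) (by lia)
    have hmem := mem_sup_of_not_le_of_algHom (γ := σ (sqrtδ i) / sqrtδ i)
      (by rw [div_pow, hσsq, hsqrtδ i hir]) hnot e.toRingHom.toRatAlgHom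
    have hle : ℚ⟮σ (δ i) / δ i⟯ ⊔ κ (j + 1) ≤ L i := by
      refine sup_le ?_ ((hκL j (by lia)).trans (hLchain j hji))
      rw [adjoin_simple_le_iff]
      exact div_mem (hmapKL σ _ hδK) (hKL i hir.le hδK)
    rw [← div_mul_cancel₀ (σ (sqrtδ i)) hs0]
    exact mul_mem (hsub (hle hmem)) hgen
  have hEq : L (i + 1) = L i ⊔ ℚ⟮sqrtδ i⟯ := by
    apply le_antisymm
    · rw [hL (i + 1) hir', adjoin_le_iff]
      intro x hx
      obtain ⟨σ, rfl⟩ := (hFmonic _ hir').exists_algEquiv_of_mem_rootSet (hFirr _ hir')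
        (hz _ hir') hx
      have hle : K (i + 1) ≤ (L i ⊔ ℚ⟮sqrtδ i⟯).comap σ.toAlgHom := by
        rw [hKsucc i hir]
        refine sup_le (fun y hy => hsub (hmapKL σ y hy)) ?_
        rw [adjoin_simple_le_iff]
        exact hσsqrt σ
      exact hle (hK (i + 1) hir' ▸ mem_adjoin_simple_self ℚ _)
    · refine sup_le (hLmono i hir) (le_trans ?_ (hKL (i + 1) hir'))
      rw [hKsucc i hir]
      exact le_sup_right
  refine ⟨hEq, finrank_extendScalars_eq_two _ (hsqrtδ i hir ▸ hKL i hir.le hδK) hEq fun hLL => ?_⟩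
  obtain ⟨v, hv, hsq, ⟨g, hg⟩, hnot⟩ := hA3 i hir
  have : Fact v.Prime := ⟨hv⟩
  have hm := hFmonic _ hir'
  refine hnot (Splits.exists_fin_prod (splits_map_zmod_of_rootSet_subset (E := Om)
    (hFmonic i hir.le) hm ?_ v hsq ?_) (hm.map _) (hm.natDegree_map _))
  · intro x hx
    exact (hL i hir.le).le (hLL.le (hZL _ hir' x hx))
  · rw [hg]
    exact Splits.prod fun k _ => Splits.X_sub_C _
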